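/- arXiv:1812.02022 — 2 statements merged into one kernel-verified Lean document; each statement's English description precedes it below -/
import Mathlib

section
/- Let d ≥ 1, ω ∈ (0,∞)^d and s > 0. If a ∈ A_s (i.e. a ∈ L¹(ℝ^{2d}) with ‖a‖_s := ∫_{ℝ^{2d}} |â(w)| e^{s‖w‖} dw < ∞), then its average ⟨a⟩ along the harmonic oscillator flow also belongs to A_s and satisfies ‖⟨a⟩‖_s ≤ ‖a‖_s. -/
open MeasureTheory Real Filter Topology
open scoped ENNReal BigOperators

noncomputable section

/-- Phase space ℝ^{2d} = (x, ξ). -/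
abbrev Pd (d : ℕ) : Type := (Fin d → ℝ) × (Fin d → ℝ)

/-- Euclidean inner product on phase space. -/
def dotP {d : ℕ} (w z : Pd d) : ℝ :=
  (∑ j, w.1 j * z.1 j) + ∑ j, w.2 j * z.2 j

/-- Euclidean norm on phase space. -/
def normP {d : ℕ} (z : Pd d) : ℝ :=
  Real.sqrt ((∑ j, (z.1 j) ^ 2) + ∑ j, (z.2 j) ^ 2)

/-- Fourier transform  â(w) = ∫ e^{-i w·z} a(z) dz. -/
def fourierT {d : ℕ} (a : Pd d → ℂ) (w : Pd d) : ℂ :=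
  ∫ z : Pd d, Complex.exp (-(Complex.I * (dotP w z))) * a z

/-- The analytic norm ‖a‖_s = ∫ |â(w)| e^{s‖w‖} dw  (with values in ℝ≥0∞). -/
def Anorm {d : ℕ} (s : ℝ) (a : Pd d → ℂ) : ℝ≥0∞ :=
  ∫⁻ w : Pd d, ENNReal.ofReal (‖fourierT a w‖ * Real.exp (s * normP w))

/-- Membership in the space A_s : integrable with finite ‖·‖_s norm. -/
def MemAs {d : ℕ} (s : ℝ) (a : Pd d → ℂ) : Prop :=
  Integrable a ∧ Anorm s a < ⊤

instance fact2pi : Fact (0 < 2 * Real.pi) := ⟨Real.two_pi_pos⟩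

/-- The circle ℝ/2πℤ. -/
abbrev Circle2pi : Type := AddCircle (2 * Real.pi)

/-- The torus 𝕋^d = ℝ^d/2πℤ^d. -/
abbrev Torus (d : ℕ) : Type := Fin d → Circle2pi

/-- Cosine on the circle. -/
def aCos : Circle2pi → ℝ := Real.cos_periodic.lift

/-- Sine on the circle. -/
def aSin : Circle2pi → ℝ := Real.sin_periodic.lift

/-- The torus action Φ_τ^H on phase space: rotation by angle τ_j in the (x_j, ξ_j)-plane. -/
def PhiT {d : ℕ} (τ : Torus d) (z : Pd d) : Pd d :=
  (fun j => aCos (τ j) * z.1 j + aSin (τ j) * z.2 j,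
   fun j => -aSin (τ j) * z.1 j + aCos (τ j) * z.2 j)

/-- The one-parameter line t ↦ tω in the torus. -/
def lineTorus {d : ℕ} (ω : Fin d → ℝ) (t : ℝ) : Torus d :=
  fun j => ((t * ω j : ℝ) : Circle2pi)

/-- The harmonic oscillator flow φ_t^H = Φ_{tω}^H. -/
def phiH {d : ℕ} (ω : Fin d → ℝ) (t : ℝ) (z : Pd d) : Pd d :=
  PhiT (lineTorus ω t) z

/-- G_ω : the closure in 𝕋^d of the orbit {tω}. -/
def Gomega {d : ℕ} (ω : Fin d → ℝ) : Set (Torus d) :=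
  closure (Set.range (lineTorus ω))

/-- ν is the normalized Haar measure of the compact subgroup G_ω :
it is a probability measure, carried by G_ω, invariant under translation by
elements of G_ω.  These properties determine it uniquely. -/
def IsHaarOnG {d : ℕ} (ω : Fin d → ℝ) (ν : Measure (Torus d)) : Prop :=
  IsProbabilityMeasure ν ∧ ν (Gomega ω)ᶜ = 0 ∧
    ∀ g ∈ Gomega ω, Measure.map (fun τ => g + τ) ν = ν

/-- The average ⟨a⟩ of a along the harmonic oscillator flow. -/
def avg {d : ℕ} (ν : Measure (Torus d)) (a : Pd d → ℂ) (z : Pd d) : ℂ :=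
  ∫ τ, a (PhiT τ z) ∂ν

theorem continuous_aCos : Continuous aCos :=
  continuous_quot_lift _ Real.continuous_cos

theorem continuous_aSin : Continuous aSin :=
  continuous_quot_lift _ Real.continuous_sin

theorem aCos_sq_add_aSin_sq (θ : Circle2pi) : aCos θ ^ 2 + aSin θ ^ 2 = 1 := by
  induction θ using QuotientAddGroup.induction_on with
  | H x => exact Real.cos_sq_add_sin_sq x

section

variable {d : ℕ}

theorem dotP_PhiT (τ : Torus d) (w z : Pd d) : dotP (PhiT τ w) (PhiT τ z) = dotP w z := by
  simp only [dotP, PhiT, ← Finset.sum_add_distrib]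
  refine Finset.sum_congr rfl fun j _ => ?_
  linear_combination (w.1 j * z.1 j + w.2 j * z.2 j) * aCos_sq_add_aSin_sq (τ j)

theorem normP_eq_sqrt_dotP (z : Pd d) : normP z = √(dotP z z) := by
  simp only [normP, dotP, pow_two]

theorem normP_PhiT (τ : Torus d) (z : Pd d) : normP (PhiT τ z) = normP z := by
  rw [normP_eq_sqrt_dotP, dotP_PhiT, normP_eq_sqrt_dotP]

theorem continuous_PhiT : Continuous fun p : Torus d × Pd d => PhiT p.1 p.2 := by
  have := continuous_aCos
  have := continuous_aSin
  unfold PhiT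
  fun_prop

theorem continuous_dotP : Continuous fun p : Pd d × Pd d => dotP p.1 p.2 := by
  unfold dotP
  fun_prop

theorem continuous_normP : Continuous (normP : Pd d → ℝ) := by
  unfold normP
  fun_prop

/-- The rotation `PhiT τ` as a linear map. -/
def PhiTLinear (τ : Torus d) : Pd d →ₗ[ℝ] Pd d where
  toFun := PhiT τ
  map_add' x y := by ext j <;> simp [PhiT] <;> ring
  map_smul' c x := by ext j <;> simp [PhiT] <;> ring

/-- The reflection `(x, ξ) ↦ (x, -ξ)` conjugates `PhiT τ` into its inverse. -/
theorem abs_det_PhiTLinear (τ : Torus d) : |LinearMap.det (PhiTLinear τ)| = 1 := by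
  let R : Pd d →ₗ[ℝ] Pd d := LinearMap.prodMap LinearMap.id (-LinearMap.id)
  have hR : R ∘ₗ R = LinearMap.id := by
    ext <;> simp [R]
  have hinv : (R ∘ₗ PhiTLinear τ) ∘ₗ (R ∘ₗ PhiTLinear τ) = LinearMap.id := by
    refine LinearMap.ext fun z => ?_
    have h := fun j => aCos_sq_add_aSin_sq (τ j)
    ext j
    · simp [R, PhiTLinear, PhiT]
      linear_combination z.1 j * h j
    · simp [R, PhiTLinear, PhiT]
      linear_combination z.2 j * h j
  have h1 := congrArg LinearMap.det hR
  have h2 := congrArg LinearMap.det hinv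
  simp only [LinearMap.det_comp, LinearMap.det_id] at h1 h2
  rw [← pow_eq_one_iff_of_nonneg (abs_nonneg _) two_ne_zero, sq_abs]
  linear_combination h2 - (LinearMap.det (PhiTLinear τ)) ^ 2 * h1

theorem measurePreserving_PhiT (τ : Torus d) :
    MeasurePreserving (PhiT τ : Pd d → Pd d) := by
  have hdet := abs_det_PhiTLinear τ
  refine ⟨(continuous_PhiT.comp (Continuous.prodMk_right τ)).measurable, ?_⟩
  have : (volume : Measure (Pd d)).IsAddHaarMeasure := Measure.prod.instIsAddHaarMeasure _ _
  have h := Measure.map_linearMap_addHaar_eq_smul_addHaar (volume : Measure (Pd d))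
    (f := PhiTLinear τ) (fun h0 => by simp [h0] at hdet)
  rw [abs_inv, hdet, inv_one, ENNReal.ofReal_one, one_smul] at h
  exact h

theorem integrable_comp_PhiT (ν : Measure (Torus d)) [IsProbabilityMeasure ν] {a : Pd d → ℂ}
    (ha : Integrable a) :
    Integrable (fun p : Torus d × Pd d => a (PhiT p.1 p.2)) (ν.prod volume) := by
  have hmp : MeasurePreserving (fun p : Torus d × Pd d => (p.1, PhiT p.1 p.2))
      (ν.prod volume) (ν.prod volume) :=
    (MeasurePreserving.id ν).skew_product continuous_PhiT.measurable
      (Filter.Eventually.of_forall fun τ => (measurePreserving_PhiT τ).map_eq)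
  exact hmp.integrable_comp_of_integrable (ha.comp_snd ν)

theorem integrable_avg (ν : Measure (Torus d)) [IsProbabilityMeasure ν] {a : Pd d → ℂ}
    (ha : Integrable a) : Integrable (avg ν a) :=
  (integrable_comp_PhiT ν ha).integral_prod_right

theorem continuous_fourierKernel :
    Continuous fun p : Pd d × Pd d => Complex.exp (-(Complex.I * (dotP p.1 p.2))) := by
  have := continuous_dotP (d := d)
  fun_prop

theorem norm_fourierKernel (w z : Pd d) :
    ‖Complex.exp (-(Complex.I * (dotP w z)))‖ = 1 := by
  simp [Complex.norm_exp]

theorem measurable_fourierT {a : Pd d → ℂ} (ha : Continuous a) : Measurable (fourierT a) := by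
  have h : Continuous fun p : Pd d × Pd d =>
      Complex.exp (-(Complex.I * (dotP p.1 p.2))) * a p.2 :=
    continuous_fourierKernel.mul (ha.comp continuous_snd)
  exact h.stronglyMeasurable.integral_prod_right.measurable

theorem fourierT_comp_PhiT {a : Pd d → ℂ} (ha : Continuous a) (τ : Torus d) (w : Pd d) :
    fourierT (fun z => a (PhiT τ z)) w = fourierT a (PhiT τ w) := by
  have hk : Continuous fun z : Pd d =>
      Complex.exp (-(Complex.I * (dotP (PhiT τ w) z))) * a z :=
    (continuous_fourierKernel.comp (Continuous.prodMk_right _)).mul ha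
  have hmp := measurePreserving_PhiT τ
  rw [fourierT, fourierT, ← hmp.map_eq,
    integral_map hmp.measurable.aemeasurable hk.aestronglyMeasurable, hmp.map_eq]
  simp only [dotP_PhiT]

theorem fourierT_avg (ν : Measure (Torus d)) [IsProbabilityMeasure ν] {a : Pd d → ℂ}
    (ha_cont : Continuous a) (ha : Integrable a) (w : Pd d) :
    fourierT (avg ν a) w = ∫ τ, fourierT a (PhiT τ w) ∂ν := by
  have hk : Continuous fun p : Torus d × Pd d =>
      Complex.exp (-(Complex.I * (dotP w p.2))) :=
    continuous_fourierKernel.comp (continuous_const.prodMk continuous_snd)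
  have hint : Integrable (fun p : Torus d × Pd d =>
      Complex.exp (-(Complex.I * (dotP w p.2))) * a (PhiT p.1 p.2)) (ν.prod volume) :=
    (integrable_comp_PhiT ν ha).bdd_mul hk.aestronglyMeasurable
      (Filter.Eventually.of_forall fun p => (norm_fourierKernel w p.2).le)
  simp only [← fourierT_comp_PhiT ha_cont]
  unfold fourierT avg
  simp only [← integral_const_mul]
  exact (integral_integral_swap hint).symm

theorem Anorm_avg_le (ν : Measure (Torus d)) [IsProbabilityMeasure ν] (s : ℝ) {a : Pd d → ℂ}
    (ha_cont : Continuous a) (ha : Integrable a) : Anorm s (avg ν a) ≤ Anorm s a := by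
  set F : Pd d → ℝ≥0∞ := fun w => ENNReal.ofReal (‖fourierT a w‖ * Real.exp (s * normP w)) with hF
  have hFm : Measurable F := by
    have := measurable_fourierT ha_cont
    have := (continuous_normP (d := d)).measurable
    fun_prop
  have hpoint (w : Pd d) : ENNReal.ofReal (‖fourierT (avg ν a) w‖ * Real.exp (s * normP w)) ≤
      ∫⁻ τ, F (PhiT τ w) ∂ν := by
    simp only [hF, normP_PhiT, ENNReal.ofReal_mul (norm_nonneg _), ofReal_norm]
    rw [lintegral_mul_const' _ _ ENNReal.ofReal_ne_top, fourierT_avg ν ha_cont ha]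
    gcongr
    exact enorm_integral_le_lintegral_enorm _
  calc Anorm s (avg ν a) ≤ ∫⁻ w, ∫⁻ τ, F (PhiT τ w) ∂ν := lintegral_mono hpoint
    _ = ∫⁻ τ, (∫⁻ w, F (PhiT τ w)) ∂ν :=
      lintegral_lintegral_swap
        (hFm.comp (continuous_PhiT.measurable.comp measurable_swap)).aemeasurable
    _ = ∫⁻ _, Anorm s a ∂ν :=
      lintegral_congr fun τ => (measurePreserving_PhiT τ).lintegral_comp hFm
    _ = Anorm s a := by simp

end

/-- If a ∈ A_s, then its average ⟨a⟩ along the harmonic oscillator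
flow also belongs to A_s and ‖⟨a⟩‖_s ≤ ‖a‖_s. -/
theorem average_mem_As {d : ℕ} (hd : 1 ≤ d) (ω : Fin d → ℝ) (hω : ∀ j, 0 < ω j)
    (s : ℝ) (hs : 0 < s) (ν : Measure (Torus d)) (hν : IsHaarOnG ω ν)
    (a : Pd d → ℂ) (ha_cont : Continuous a) (ha_bdd : ∃ M, ∀ z, ‖a z‖ ≤ M)
    (ha_L1 : Integrable a) (ha_s : Anorm s a < ⊤) :
    Integrable (avg ν a) ∧ Anorm s (avg ν a) ≤ Anorm s a := by
  have := hν.1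
  exact ⟨integrable_avg ν ha_L1, Anorm_avg_le ν s ha_cont ha_L1⟩

end
end

section
/- Let s > 0 and let σ₁ > 0, σ₂ > 0 with σ₁ + σ₂ < s. For all a, b ∈ A_s, the Poisson bracket {a,b} belongs to A_{s−σ₁−σ₂} and ‖{a,b}‖_{s−σ₁−σ₂} ≤ (2 / (e² σ₁(σ₁+σ₂))) ‖a‖_s ‖b‖_{s−σ₂}. -/
open MeasureTheory Real Filter Topology
open scoped ENNReal BigOperators

noncomputable section

/-- The standard symplectic form ς((x,ξ),(y,η)) = ξ·y − x·η. -/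
def symp {d : ℕ} (w v : Pd d) : ℝ :=
  (∑ j, w.2 j * v.1 j) - ∑ j, w.1 j * v.2 j

/-- The Moyal product a ♯_ℏ b. -/
def moyal {d : ℕ} (ℏ : ℝ) (a b : Pd d → ℂ) (z : Pd d) : ℂ :=
  (((2 * Real.pi) ^ (4 * d) : ℝ) : ℂ)⁻¹ *
    ∫ p : Pd d × Pd d,
      fourierT a p.1 * fourierT b (p.2 - p.1) *
        Complex.exp (Complex.I * ℏ / 2 * (symp p.1 (p.2 - p.1) : ℝ)) *
        Complex.exp (Complex.I * (dotP p.2 z : ℝ))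

/-- The Moyal commutator [a,b]_ℏ = a ♯_ℏ b − b ♯_ℏ a. -/
def moyalComm {d : ℕ} (ℏ : ℝ) (a b : Pd d → ℂ) : Pd d → ℂ :=
  fun z => moyal ℏ a b z - moyal ℏ b a z

/-- Coordinate vector in the x_j direction. -/
def ex {d : ℕ} (j : Fin d) : Pd d := (Pi.single j 1, 0)

/-- Coordinate vector in the ξ_j direction. -/
def exi {d : ℕ} (j : Fin d) : Pd d := (0, Pi.single j 1)

/-- Directional derivative of a complex-valued symbol. -/
def pdC {d : ℕ} (v : Pd d) (f : Pd d → ℂ) (z : Pd d) : ℂ := fderiv ℝ f z v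

/-- The Poisson bracket {a,b} = Σ_j (∂_{ξ_j}a ∂_{x_j}b − ∂_{x_j}a ∂_{ξ_j}b). -/
def poisson {d : ℕ} (a b : Pd d → ℂ) (z : Pd d) : ℂ :=
  ∑ j, (pdC (exi j) a z * pdC (ex j) b z - pdC (ex j) a z * pdC (exi j) b z)

/-- Iterated Moyal adjoint Ad_G^{♯ℏ,j}(a). -/
def adM {d : ℕ} (ℏ : ℝ) (G : Pd d → ℂ) : ℕ → (Pd d → ℂ) → (Pd d → ℂ)
  | 0, a => a
  | j + 1, a => moyalComm ℏ G (adM ℏ G j a)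

/-- The j-th term of the series defining Ψ_t^{G,ℏ} a. -/
def psiTerm {d : ℕ} (t ℏ : ℝ) (G a : Pd d → ℂ) (j : ℕ) : Pd d → ℂ :=
  fun z => ((Complex.I * t / ℏ) ^ j / (j.factorial : ℂ)) * adM ℏ G j a z

/-- Ψ_t^{G,ℏ} a = Σ_j (1/j!)(it/ℏ)^j Ad_G^{♯ℏ,j}(a). -/
def Psi {d : ℕ} (t ℏ : ℝ) (G a : Pd d → ℂ) (z : Pd d) : ℂ :=
  ∑' j : ℕ, psiTerm t ℏ G a j z
section FourierL2

open FourierTransform SchwartzMap Convolution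
open scoped ContDiff

variable {V : Type*} [NormedAddCommGroup V] [InnerProductSpace ℝ V] [FiniteDimensional ℝ V]
  [MeasurableSpace V] [BorelSpace V]

/-- The Fourier transform of integrable functions is self-adjoint. -/
theorem integral_mul_fourier_eq_flip {f g : V → ℂ} (hf : Integrable f) (hg : Integrable g) :
    ∫ x, 𝓕 f x * g x = ∫ x, f x * 𝓕 g x := by
  simpa using! VectorFourier.integral_fourierIntegral_smul_eq_flip (L := innerₗ V)
    continuous_fourierChar continuous_inner hf hg

/-- The inverse Fourier transform of integrable functions is self-adjoint. -/
theorem integral_mul_fourierInv_eq_flip {f g : V → ℂ} (hf : Integrable f) (hg : Integrable g) :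
    ∫ x, 𝓕⁻ f x * g x = ∫ x, f x * 𝓕⁻ g x := by
  simp_rw [fourierInv_eq_fourier_neg]
  rw [← integral_neg_eq_self]
  simp only [neg_neg]
  rw [integral_mul_fourier_eq_flip hf hg.comp_neg, ← fourierInv_eq_fourier_comp_neg]
  simp_rw [fourierInv_eq_fourier_neg]

/-- Locally integrable functions that agree as distributions agree almost everywhere. -/
theorem ae_eq_of_forall_integral_schwartz_mul_eq {f g : V → ℂ} (hf : LocallyIntegrable f)
    (hg : LocallyIntegrable g) (h : ∀ φ : 𝓢(V, ℂ), ∫ x, φ x * f x = ∫ x, φ x * g x) :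
    f =ᵐ[volume] g := by
  refine ae_eq_of_integral_contDiff_smul_eq hf hg fun φ hφ hφc ↦ ?_
  have hc : HasCompactSupport fun x ↦ (φ x : ℂ) := hφc.comp_left Complex.ofReal_zero
  have hd : ContDiff ℝ ∞ fun x ↦ (φ x : ℂ) := Complex.ofRealCLM.contDiff.comp hφ
  simpa using h (hc.toSchwartzMap hd)

theorem fourier_ae_eq_of_fourierInv_eq {h P : V → ℂ} (hh : Integrable h) (hP : Integrable P)
    (hPh : P = 𝓕⁻ h) : 𝓕 P =ᵐ[volume] h := by
  have hc : Continuous (𝓕 P) := VectorFourier.fourierIntegral_continuous continuous_fourierChar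
    continuous_inner hP
  refine ae_eq_of_forall_integral_schwartz_mul_eq hc.locallyIntegrable hh.locallyIntegrable
    fun φ ↦ ?_
  calc ∫ x, φ x * 𝓕 P x = ∫ x, 𝓕 (φ : V → ℂ) x * P x :=
        (integral_mul_fourier_eq_flip φ.integrable hP).symm
    _ = ∫ x, (𝓕 φ : 𝓢(V, ℂ)) x * 𝓕⁻ h x := by rw [hPh, fourier_coe]
    _ = ∫ x, 𝓕⁻ ((𝓕 φ : 𝓢(V, ℂ)) : V → ℂ) x * h x :=
        (integral_mul_fourierInv_eq_flip (𝓕 φ : 𝓢(V, ℂ)).integrable hh).symm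
    _ = ∫ x, φ x * h x := by
        rw [← fourierInv_coe, FourierTransform.fourierInv_fourier_eq]

/-- The inverse Fourier integral of a function in `L¹ ∩ L²` lies in `L²`. -/
theorem memLp_two_fourierInv {f : V → ℂ} (hf : Integrable f) (hf2 : MemLp f 2) :
    MemLp (𝓕⁻ f) 2 := by
  have hc : Continuous (𝓕⁻ f) := by
    rw [fourierInv_eq_fourier_comp_neg]
    exact VectorFourier.fourierIntegral_continuous continuous_fourierChar
      continuous_inner hf.comp_neg
  refine (memLp_congr_ae ?_).1 (Lp.memLp (𝓕⁻ (hf2.toLp f)))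
  refine ae_eq_of_forall_integral_schwartz_mul_eq
    ((Lp.memLp _).locallyIntegrable one_le_two) hc.locallyIntegrable fun φ ↦ ?_
  have h := congrArg (fun T ↦ T φ) (Lp.fourierInv_toTemperedDistribution_eq (hf2.toLp f))
  simp only [TemperedDistribution.fourierInv_apply, Lp.toTemperedDistribution_apply,
    smul_eq_mul] at h
  rw [← h, ← integral_mul_fourierInv_eq_flip φ.integrable hf, ← fourierInv_coe]
  refine integral_congr_ae ?_
  filter_upwards [hf2.coeFn_toLp] with x hx
  rw [hx]

theorem fourierInv_convolution_eq {f g : V → ℂ} (hf : Integrable f) (hg : Integrable g) :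
    𝓕⁻ (f ⋆[ContinuousLinearMap.mul ℂ ℂ] g) = fun x ↦ 𝓕⁻ f x * 𝓕⁻ g x := by
  ext x
  simp_rw [fourierInv_eq_fourier_neg]
  exact Real.fourier_mul_convolution_eq hf hg _

theorem integrable_fourierInv_mul {f g : V → ℂ} (hf : Integrable f) (hf2 : MemLp f 2)
    (hg : Integrable g) (hg2 : MemLp g 2) : Integrable fun x ↦ 𝓕⁻ f x * 𝓕⁻ g x :=
  (memLp_two_fourierInv hf hf2).integrable_mul (memLp_two_fourierInv hg hg2)

theorem fderiv_fourierInv_apply {f : V → ℂ} (hf : Integrable f)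
    (hf' : Integrable fun w ↦ ‖w‖ * ‖f w‖) (x v : V) :
    fderiv ℝ (𝓕⁻ f) x v = 𝓕⁻ (fun w ↦ 2 * π * Complex.I * (inner ℝ w v : ℝ) * f w) x := by
  have h1 : Integrable fun w ↦ f (-w) := hf.comp_neg
  have h2 : Integrable fun w ↦ ‖w‖ * ‖f (-w)‖ := by simpa using hf'.comp_neg
  have h3 : Integrable (VectorFourier.fourierSMulRight (innerSL ℝ) fun w ↦ f (-w)) := by
    refine (h2.const_mul (2 * π * ‖innerSL (E := V) ℝ‖)).mono'
      (h1.aestronglyMeasurable.fourierSMulRight) (ae_of_all _ fun w ↦ ?_)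
    exact (VectorFourier.norm_fourierSMulRight_le _ _ _).trans_eq (by ring)
  rw [fourierInv_eq_fourier_comp_neg, Real.fderiv_fourier h1 h2,
    fourierInv_eq_fourier_comp_neg, Real.fourier_continuousLinearMap_apply h3]
  refine congrFun (congrArg _ (funext fun w ↦ ?_)) x
  simp [VectorFourier.fourierSMulRight_apply, innerSL_apply_apply ℝ]
  ring

/-- The analytic norm `∫ ‖𝓕 A w‖ e^{s‖w‖} dw` on an inner product space. -/
def fourierExpNorm (s : ℝ) (A : V → ℂ) : ℝ≥0∞ :=
  ∫⁻ w, ‖𝓕 A w‖ₑ * ENNReal.ofReal (exp (s * ‖w‖))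

/-- The Fourier transform of the derivative of `A` in the direction `v`. -/
def derivSymbol (A : V → ℂ) (v w : V) : ℂ := 2 * π * Complex.I * (inner ℝ w v : ℝ) * 𝓕 A w

theorem continuous_fourier_of_integrable {A : V → ℂ} (hA : Integrable A) : Continuous (𝓕 A) :=
  VectorFourier.fourierIntegral_continuous continuous_fourierChar continuous_inner hA

theorem continuous_derivSymbol {A : V → ℂ} (hA : Integrable A) (v : V) :
    Continuous (derivSymbol A v) := by
  have := continuous_fourier_of_integrable hA
  unfold derivSymbol
  fun_prop

theorem norm_derivSymbol (A : V → ℂ) (v w : V) :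
    ‖derivSymbol A v w‖ = 2 * π * |inner ℝ w v| * ‖𝓕 A w‖ := by
  simp [derivSymbol, abs_of_pos pi_pos]

theorem norm_derivSymbol_le (A : V → ℂ) (v w : V) :
    ‖derivSymbol A v w‖ ≤ 2 * π * ‖v‖ * (‖w‖ * ‖𝓕 A w‖) := by
  rw [norm_derivSymbol]
  calc 2 * π * |inner ℝ w v| * ‖𝓕 A w‖ ≤ 2 * π * (‖w‖ * ‖v‖) * ‖𝓕 A w‖ := by
        gcongr
        exact abs_real_inner_le_norm w v
    _ = _ := by ring

theorem integrable_pow_mul_norm_fourier {A : V → ℂ} (hA : Integrable A) {s : ℝ} (hs : 0 < s)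
    (h : fourierExpNorm s A < ⊤) (k : ℕ) : Integrable fun w ↦ ‖w‖ ^ k * ‖𝓕 A w‖ := by
  have hc := continuous_fourier_of_integrable hA
  have hexp : Integrable fun w ↦ exp (s * ‖w‖) * ‖𝓕 A w‖ := by
    refine ⟨by fun_prop, ?_⟩
    refine lt_of_le_of_lt (lintegral_mono fun w ↦ ?_) h
    rw [enorm_mul, enorm_norm, mul_comm, Real.enorm_of_nonneg (exp_pos _).le]
  refine (hexp.const_mul (k.factorial / s ^ k)).mono' (by fun_prop) (ae_of_all _ fun w ↦ ?_)
  rw [norm_mul, norm_pow, norm_norm, norm_norm, ← mul_assoc]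
  gcongr
  have := pow_div_factorial_le_exp (s * ‖w‖) (by positivity) k
  rw [mul_pow, div_le_iff₀ (by positivity)] at this
  rw [div_mul_eq_mul_div, le_div_iff₀ (by positivity)]
  linarith

theorem integrable_fourier_of_fourierExpNorm {A : V → ℂ} (hA : Integrable A) {s : ℝ} (hs : 0 < s)
    (h : fourierExpNorm s A < ⊤) : Integrable (𝓕 A) := by
  have hc := continuous_fourier_of_integrable hA
  rw [← integrable_norm_iff (by fun_prop)]
  simpa using integrable_pow_mul_norm_fourier hA hs h 0

theorem integrable_derivSymbol {A : V → ℂ} (hA : Integrable A) {s : ℝ} (hs : 0 < s)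
    (h : fourierExpNorm s A < ⊤) (v : V) : Integrable (derivSymbol A v) := by
  refine ((integrable_pow_mul_norm_fourier hA hs h 1).const_mul (2 * π * ‖v‖)).mono'
    (continuous_derivSymbol hA v).aestronglyMeasurable (ae_of_all _ fun w ↦ ?_)
  simpa using norm_derivSymbol_le A v w

theorem memLp_two_derivSymbol {A : V → ℂ} (hA : Integrable A) {s : ℝ} (hs : 0 < s)
    (h : fourierExpNorm s A < ⊤) (v : V) : MemLp (derivSymbol A v) 2 := by
  have hc := continuous_derivSymbol hA v
  rw [memLp_two_iff_integrable_sq_norm hc.aestronglyMeasurable]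
  refine ((integrable_pow_mul_norm_fourier hA hs h 2).const_mul
    ((2 * π * ‖v‖) ^ 2 * ∫ x, ‖A x‖)).mono' (by fun_prop) (ae_of_all _ fun w ↦ ?_)
  have hM : ‖𝓕 A w‖ ≤ ∫ x, ‖A x‖ :=
    VectorFourier.norm_fourierIntegral_le_integral_norm _ _ _ _ _
  rw [norm_pow, norm_norm]
  calc ‖derivSymbol A v w‖ ^ 2 ≤ (2 * π * ‖v‖ * (‖w‖ * ‖𝓕 A w‖)) ^ 2 := by
        gcongr
        exact norm_derivSymbol_le A v w
    _ = (2 * π * ‖v‖) ^ 2 * ‖𝓕 A w‖ * (‖w‖ ^ 2 * ‖𝓕 A w‖) := by ring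
    _ ≤ _ := by gcongr

theorem fderiv_apply_eq_fourierInv_derivSymbol {A : V → ℂ} (hAc : Continuous A)
    (hA : Integrable A) {s : ℝ} (hs : 0 < s) (h : fourierExpNorm s A < ⊤) (x v : V) :
    fderiv ℝ A x v = 𝓕⁻ (derivSymbol A v) x := by
  have hF := integrable_fourier_of_fourierExpNorm hA hs h
  conv_lhs => rw [← hAc.fourierInv_fourier_eq hA hF]
  exact fderiv_fourierInv_apply hF (by simpa using integrable_pow_mul_norm_fourier hA hs h 1) x v

theorem integrable_fderiv_mul_fderiv {A B : V → ℂ} (hAc : Continuous A) (hA : Integrable A)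
    (hBc : Continuous B) (hB : Integrable B) {s t : ℝ} (hs : 0 < s) (ht : 0 < t)
    (hAs : fourierExpNorm s A < ⊤) (hBt : fourierExpNorm t B < ⊤) (v v' : V) :
    Integrable fun x ↦ fderiv ℝ A x v * fderiv ℝ B x v' := by
  simp_rw [fderiv_apply_eq_fourierInv_derivSymbol hAc hA hs hAs,
    fderiv_apply_eq_fourierInv_derivSymbol hBc hB ht hBt]
  exact integrable_fourierInv_mul (integrable_derivSymbol hA hs hAs v)
    (memLp_two_derivSymbol hA hs hAs v) (integrable_derivSymbol hB ht hBt v')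
    (memLp_two_derivSymbol hB ht hBt v')

theorem enorm_fourier_fderiv_mul_fderiv_le {A B : V → ℂ} (hAc : Continuous A) (hA : Integrable A)
    (hBc : Continuous B) (hB : Integrable B) {s t : ℝ} (hs : 0 < s) (ht : 0 < t)
    (hAs : fourierExpNorm s A < ⊤) (hBt : fourierExpNorm t B < ⊤) (v v' : V) :
    ∀ᵐ w, ‖𝓕 (fun x ↦ fderiv ℝ A x v * fderiv ℝ B x v') w‖ₑ ≤
      ∫⁻ u, ‖derivSymbol A v u‖ₑ * ‖derivSymbol B v' (w - u)‖ₑ := by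
  have hf := integrable_derivSymbol hA hs hAs v
  have hg := integrable_derivSymbol hB ht hBt v'
  have hP := integrable_fderiv_mul_fderiv hAc hA hBc hB hs ht hAs hBt v v'
  have hh : Integrable (derivSymbol A v ⋆[ContinuousLinearMap.mul ℂ ℂ] derivSymbol B v') :=
    hf.integrable_convolution _ hg
  have hPh : (fun x ↦ fderiv ℝ A x v * fderiv ℝ B x v') =
      𝓕⁻ (derivSymbol A v ⋆[ContinuousLinearMap.mul ℂ ℂ] derivSymbol B v') := by
    simp_rw [fderiv_apply_eq_fourierInv_derivSymbol hAc hA hs hAs,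
      fderiv_apply_eq_fourierInv_derivSymbol hBc hB ht hBt]
    exact (fourierInv_convolution_eq hf hg).symm
  filter_upwards [fourier_ae_eq_of_fourierInv_eq hh hP hPh] with w hw
  rw [hw, convolution_def]
  refine (enorm_integral_le_lintegral_enorm _).trans_eq ?_
  simp

theorem enorm_fourier_sum_sub_le {ι : Type*} [Fintype ι] {F G : ι → V → ℂ}
    (hF : ∀ j, Integrable (F j)) (hG : ∀ j, Integrable (G j)) (w : V) :
    ‖𝓕 (fun x ↦ ∑ j, (F j x - G j x)) w‖ₑ ≤ ∑ j, (‖𝓕 (F j) w‖ₑ + ‖𝓕 (G j) w‖ₑ) := by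
  have h1 (j) := (Real.fourierIntegral_convergent_iff w).2 (hF j)
  have h2 (j) := (Real.fourierIntegral_convergent_iff w).2 (hG j)
  have : 𝓕 (fun x ↦ ∑ j, (F j x - G j x)) w = ∑ j, (𝓕 (F j) w - 𝓕 (G j) w) := by
    simp_rw [Real.fourier_eq, Finset.smul_sum, smul_sub]
    rw [integral_finsetSum _ fun j _ ↦ by exact (h1 j).sub (h2 j)]
    exact Finset.sum_congr rfl fun j _ ↦ integral_sub (h1 j) (h2 j)
  rw [this]
  exact (enorm_sum_le _ _).trans (Finset.sum_le_sum fun j _ ↦ enorm_sub_le)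

theorem lintegral_lintegral_mul_sub {F G : V → ℝ≥0∞} (hF : Measurable F) (hG : Measurable G) :
    ∫⁻ w, ∫⁻ u, F u * G (w - u) = (∫⁻ u, F u) * ∫⁻ u, G u := by
  rw [lintegral_lintegral_swap (by fun_prop)]
  have (u : V) : ∫⁻ w, F u * G (w - u) = F u * ∫⁻ w, G w := by
    rw [lintegral_const_mul _ (by fun_prop), lintegral_sub_right_eq_self]
  simp_rw [this]
  exact lintegral_mul_const _ hF

theorem mul_exp_le_of_pos {σ : ℝ} (hσ : 0 < σ) (s r : ℝ) :
    r * exp (s * r) ≤ 1 / (exp 1 * σ) * exp ((s + σ) * r) := by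
  have h1 : σ * r ≤ exp (σ * r - 1) := by linarith [add_one_le_exp (σ * r - 1)]
  have h2 : exp ((s + σ) * r) = exp 1 * exp (σ * r - 1) * exp (s * r) := by
    rw [← exp_add, ← exp_add]
    ring_nf
  have h3 : 1 / (exp 1 * σ) * exp ((s + σ) * r) = exp (σ * r - 1) / σ * exp (s * r) := by
    rw [h2]
    field_simp
  rw [h3]
  gcongr
  rw [le_div_iff₀ hσ]
  linarith

theorem lintegral_norm_mul_fourier_le (A : V → ℂ) {σ : ℝ} (hσ : 0 < σ) (s : ℝ) :
    ∫⁻ w, ENNReal.ofReal (‖w‖ * ‖𝓕 A w‖ * exp (s * ‖w‖)) ≤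
      ENNReal.ofReal (1 / (exp 1 * σ)) * fourierExpNorm (s + σ) A := by
  rw [fourierExpNorm, ← lintegral_const_mul' _ _ ENNReal.ofReal_ne_top]
  refine lintegral_mono fun w ↦ ?_
  rw [← ofReal_norm, ← ENNReal.ofReal_mul (norm_nonneg _), ← ENNReal.ofReal_mul (by positivity)]
  refine ENNReal.ofReal_le_ofReal ?_
  calc ‖w‖ * ‖𝓕 A w‖ * exp (s * ‖w‖) = ‖𝓕 A w‖ * (‖w‖ * exp (s * ‖w‖)) := by ring
    _ ≤ ‖𝓕 A w‖ * (1 / (exp 1 * σ) * exp ((s + σ) * ‖w‖)) := by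
        gcongr ?_ * ?_
        exact mul_exp_le_of_pos hσ s _
    _ = _ := by ring

/-- The Poisson bracket with respect to finite families of conjugate directions `p j`, `q j`. -/
def bracket {ι : Type*} [Fintype ι] (p q : ι → V) (A B : V → ℂ) (x : V) : ℂ :=
  ∑ j, (fderiv ℝ A x (q j) * fderiv ℝ B x (p j) - fderiv ℝ A x (p j) * fderiv ℝ B x (q j))

theorem integrable_bracket {ι : Type*} [Fintype ι] (p q : ι → V) {A B : V → ℂ}
    (hAc : Continuous A) (hA : Integrable A) (hBc : Continuous B) (hB : Integrable B) {s t : ℝ}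
    (hs : 0 < s) (ht : 0 < t) (hAs : fourierExpNorm s A < ⊤) (hBt : fourierExpNorm t B < ⊤) :
    Integrable (bracket p q A B) :=
  integrable_finsetSum _ fun _ _ ↦
    (integrable_fderiv_mul_fderiv hAc hA hBc hB hs ht hAs hBt _ _).sub
      (integrable_fderiv_mul_fderiv hAc hA hBc hB hs ht hAs hBt _ _)

theorem fourierExpNorm_bracket_le {ι : Type*} [Fintype ι] {p q : ι → V}
    (hpq : ∀ u v : V, ∑ j, (|inner ℝ u (q j)| * |inner ℝ v (p j)| +
      |inner ℝ u (p j)| * |inner ℝ v (q j)|) ≤ ‖u‖ * ‖v‖)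
    {A B : V → ℂ} (hAc : Continuous A) (hA : Integrable A) (hBc : Continuous B)
    (hB : Integrable B) {s σ τ : ℝ} (hs : 0 < s) (hσ : 0 < σ) (hτ : 0 < τ)
    (hAs : fourierExpNorm (s + σ) A < ⊤) (hBs : fourierExpNorm (s + τ) B < ⊤) :
    fourierExpNorm s (bracket p q A B) ≤ ENNReal.ofReal ((2 * π) ^ 2) *
      ((ENNReal.ofReal (1 / (exp 1 * σ)) * fourierExpNorm (s + σ) A) *
        (ENNReal.ofReal (1 / (exp 1 * τ)) * fourierExpNorm (s + τ) B)) := by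
  have hsσ : 0 < s + σ := by positivity
  have hsτ : 0 < s + τ := by positivity
  have hcA := continuous_fourier_of_integrable hA
  have hcB := continuous_fourier_of_integrable hB
  have hdA := continuous_derivSymbol hA
  have hdB := continuous_derivSymbol hB
  have hint := integrable_fderiv_mul_fderiv hAc hA hBc hB hsσ hsτ hAs hBs
  have hle := enorm_fourier_fderiv_mul_fderiv_le hAc hA hBc hB hsσ hsτ hAs hBs
  have hpt (u v : V) : ∑ j, (‖derivSymbol A (q j) u‖ₑ * ‖derivSymbol B (p j) v‖ₑ +
      ‖derivSymbol A (p j) u‖ₑ * ‖derivSymbol B (q j) v‖ₑ) ≤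
      ENNReal.ofReal ((2 * π) ^ 2 * ((‖u‖ * ‖𝓕 A u‖) * (‖v‖ * ‖𝓕 B v‖))) := by
    simp_rw [← ofReal_norm, ← ENNReal.ofReal_mul (norm_nonneg _)]
    simp_rw [← ENNReal.ofReal_add (mul_nonneg (norm_nonneg _) (norm_nonneg _))
      (mul_nonneg (norm_nonneg _) (norm_nonneg _))]
    rw [← ENNReal.ofReal_sum_of_nonneg fun _ _ ↦ by positivity]
    refine ENNReal.ofReal_le_ofReal ?_
    simp_rw [norm_derivSymbol]
    calc _ = (2 * π) ^ 2 * (∑ j, (|inner ℝ u (q j)| * |inner ℝ v (p j)| +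
          |inner ℝ u (p j)| * |inner ℝ v (q j)|)) * (‖𝓕 A u‖ * ‖𝓕 B v‖) := by
          rw [Finset.mul_sum, Finset.sum_mul]
          exact Finset.sum_congr rfl fun j _ ↦ by ring
      _ ≤ (2 * π) ^ 2 * (‖u‖ * ‖v‖) * (‖𝓕 A u‖ * ‖𝓕 B v‖) := by
          gcongr
          exact hpq u v
      _ = _ := by ring
  have hconv : ∀ᵐ w, ‖𝓕 (bracket p q A B) w‖ₑ * ENNReal.ofReal (exp (s * ‖w‖)) ≤
      ENNReal.ofReal ((2 * π) ^ 2) * ∫⁻ u, ENNReal.ofReal (‖u‖ * ‖𝓕 A u‖ * exp (s * ‖u‖)) *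
        ENNReal.ofReal (‖w - u‖ * ‖𝓕 B (w - u)‖ * exp (s * ‖w - u‖)) := by
    filter_upwards [ae_all_iff.2 fun j ↦ hle (q j) (p j), ae_all_iff.2 fun j ↦ hle (p j) (q j)]
      with w h1 h2
    calc ‖𝓕 (bracket p q A B) w‖ₑ * ENNReal.ofReal (exp (s * ‖w‖))
        ≤ (∑ j, ((∫⁻ u, ‖derivSymbol A (q j) u‖ₑ * ‖derivSymbol B (p j) (w - u)‖ₑ) +
            ∫⁻ u, ‖derivSymbol A (p j) u‖ₑ * ‖derivSymbol B (q j) (w - u)‖ₑ)) *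
            ENNReal.ofReal (exp (s * ‖w‖)) := by
          gcongr
          exact (enorm_fourier_sum_sub_le (fun j ↦ hint (q j) (p j))
            (fun j ↦ hint (p j) (q j)) w).trans
              (Finset.sum_le_sum fun j _ ↦ add_le_add (h1 j) (h2 j))
      _ = ∫⁻ u, (∑ j, (‖derivSymbol A (q j) u‖ₑ * ‖derivSymbol B (p j) (w - u)‖ₑ +
            ‖derivSymbol A (p j) u‖ₑ * ‖derivSymbol B (q j) (w - u)‖ₑ)) *
            ENNReal.ofReal (exp (s * ‖w‖)) := by
          rw [lintegral_mul_const' _ _ ENNReal.ofReal_ne_top,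
            lintegral_finsetSum _ fun j _ ↦ by fun_prop]
          congr 1
          exact Finset.sum_congr rfl fun j _ ↦ (lintegral_add_left (by fun_prop) _).symm
      _ ≤ ∫⁻ u, ENNReal.ofReal ((2 * π) ^ 2) *
            (ENNReal.ofReal (‖u‖ * ‖𝓕 A u‖ * exp (s * ‖u‖)) *
            ENNReal.ofReal (‖w - u‖ * ‖𝓕 B (w - u)‖ * exp (s * ‖w - u‖))) := by
          refine lintegral_mono fun u ↦ ?_
          refine (mul_le_mul_left (hpt u (w - u)) _).trans ?_
          rw [← ENNReal.ofReal_mul (by positivity), ← ENNReal.ofReal_mul (by positivity),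
            ← ENNReal.ofReal_mul (by positivity)]
          refine ENNReal.ofReal_le_ofReal ?_
          have hexp : exp (s * ‖w‖) ≤ exp (s * ‖u‖) * exp (s * ‖w - u‖) := by
            rw [← exp_add, ← mul_add]
            gcongr
            simpa using norm_add_le u (w - u)
          calc _ ≤ (2 * π) ^ 2 * (‖u‖ * ‖𝓕 A u‖ * (‖w - u‖ * ‖𝓕 B (w - u)‖)) *
                (exp (s * ‖u‖) * exp (s * ‖w - u‖)) := by gcongr
            _ = _ := by ring
      _ = _ := lintegral_const_mul' _ _ ENNReal.ofReal_ne_top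
  refine (lintegral_mono_ae hconv).trans ?_
  rw [lintegral_const_mul' _ _ ENNReal.ofReal_ne_top, lintegral_lintegral_mul_sub
    (F := fun u ↦ ENNReal.ofReal (‖u‖ * ‖𝓕 A u‖ * exp (s * ‖u‖)))
    (G := fun u ↦ ENNReal.ofReal (‖u‖ * ‖𝓕 B u‖ * exp (s * ‖u‖)))
    (by fun_prop) (by fun_prop)]
  gcongr
  · exact lintegral_norm_mul_fourier_le A hσ s
  · exact lintegral_norm_mul_fourier_le B hτ s

end FourierL2

section PhaseSpace

open FourierTransform

/-- Phase space as a Euclidean space. -/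
abbrev PhaseE (d : ℕ) : Type := EuclideanSpace ℝ (Fin d ⊕ Fin d)

/-- The identification of Euclidean phase space with `Pd d`. -/
def toPd (d : ℕ) : PhaseE d ≃L[ℝ] Pd d :=
  (LinearEquiv.toContinuousLinearEquiv
    { toFun := fun v ↦ (fun j ↦ v (Sum.inl j), fun j ↦ v (Sum.inr j))
      invFun := fun z ↦ WithLp.toLp 2 (Sum.elim z.1 z.2)
      map_add' := fun _ _ ↦ rfl
      map_smul' := fun _ _ ↦ rfl
      left_inv := fun v ↦ by
        ext (j | j) <;> rfl
      right_inv := fun _ ↦ rfl })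

variable {d : ℕ}

theorem toPd_apply (v : PhaseE d) :
    toPd d v = (fun j ↦ v (Sum.inl j), fun j ↦ v (Sum.inr j)) := rfl

theorem measurePreserving_toPd : MeasurePreserving (toPd d) :=
  (volume_measurePreserving_sumPiEquivProdPi fun _ : Fin d ⊕ Fin d ↦ ℝ).comp
    (PiLp.volume_preserving_ofLp (Fin d ⊕ Fin d))

theorem measurableEmbedding_toPd : MeasurableEmbedding (toPd d) :=
  (toPd d).toHomeomorph.measurableEmbedding

theorem dotP_toPd (w v : PhaseE d) : dotP (toPd d w) (toPd d v) = inner ℝ v w := by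
  simp [dotP, toPd_apply, PiLp.inner_apply]

theorem normP_toPd (v : PhaseE d) : normP (toPd d v) = ‖v‖ := by
  simp [normP, toPd_apply, EuclideanSpace.norm_eq]

/-- A symbol read on Euclidean phase space, rescaled so that its Fourier transform in Mathlib's
normalization has the same frequencies as `fourierT`. -/
def rescaled (a : Pd d → ℂ) (x : PhaseE d) : ℂ := a (toPd d ((2 * π) • x))

theorem continuous_rescaled {a : Pd d → ℂ} (ha : Continuous a) : Continuous (rescaled a) := by
  unfold rescaled
  fun_prop

theorem integrable_rescaled_iff {a : Pd d → ℂ} : Integrable (rescaled a) ↔ Integrable a :=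
  (integrable_comp_smul_iff volume (fun x ↦ a (toPd d x)) two_pi_pos.ne').trans
    (measurePreserving_toPd.integrable_comp_emb measurableEmbedding_toPd)

theorem fourierT_toPd (a : Pd d → ℂ) (w : PhaseE d) :
    fourierT a (toPd d w) =
      ((2 * π) ^ Module.finrank ℝ (PhaseE d) : ℝ) • 𝓕 (rescaled a) w := by
  have h := Measure.integral_comp_smul volume
    (fun x : PhaseE d ↦ Complex.exp (-(Complex.I * (inner ℝ x w : ℝ))) * a (toPd d x)) (2 * π)
  rw [abs_of_pos (by positivity)] at h
  rw [fourierT, ← measurePreserving_toPd.integral_comp measurableEmbedding_toPd]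
  simp_rw [dotP_toPd]
  rw [Real.fourier_eq', ← smul_inv_smul₀ (a := ((2 * π) ^ Module.finrank ℝ (PhaseE d) : ℝ))
    (by positivity) (∫ x, _), ← h]
  congr 2
  ext x
  rw [inner_smul_left, rescaled, smul_eq_mul]
  congr 2
  simp
  ring

theorem Anorm_eq_fourierExpNorm (s : ℝ) (a : Pd d → ℂ) :
    Anorm s a = ENNReal.ofReal ((2 * π) ^ Module.finrank ℝ (PhaseE d)) *
      fourierExpNorm s (rescaled a) := by
  rw [Anorm, ← measurePreserving_toPd.lintegral_comp_emb measurableEmbedding_toPd, fourierExpNorm,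
    ← lintegral_const_mul' _ _ ENNReal.ofReal_ne_top]
  refine lintegral_congr fun w ↦ ?_
  rw [fourierT_toPd, normP_toPd, norm_smul, ← ofReal_norm, ← ENNReal.ofReal_mul (norm_nonneg _),
    ← ENNReal.ofReal_mul (by positivity), Real.norm_of_nonneg (by positivity), mul_assoc]

theorem fourierExpNorm_lt_top {s : ℝ} {a : Pd d → ℂ} (h : Anorm s a < ⊤) :
    fourierExpNorm s (rescaled a) < ⊤ := by
  rw [Anorm_eq_fourierExpNorm] at h
  exact ENNReal.lt_top_of_mul_ne_top_right h.ne
    (ENNReal.ofReal_pos.2 (by positivity)).ne'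

theorem fderiv_rescaled (a : Pd d → ℂ) (x v : PhaseE d) :
    fderiv ℝ (rescaled a) x v = 2 * π * pdC (toPd d v) a (toPd d ((2 * π) • x)) := by
  have h1 : fderiv ℝ (rescaled a) x = (2 * π) • fderiv ℝ (a ∘ toPd d) ((2 * π) • x) :=
    fderiv_comp_smul (f := a ∘ toPd d) (2 * π)
  rw [h1, (toPd d).comp_right_fderiv]
  simp [pdC]

theorem fourierExpNorm_const_mul {V : Type*} [NormedAddCommGroup V] [InnerProductSpace ℝ V]
    [FiniteDimensional ℝ V] [MeasurableSpace V] [BorelSpace V] (s : ℝ) {c : ℝ} (hc : 0 ≤ c)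
    (A : V → ℂ) : fourierExpNorm s (fun x ↦ c * A x) = ENNReal.ofReal c * fourierExpNorm s A := by
  have h (w : V) : 𝓕 (fun x ↦ c * A x) w = c * 𝓕 A w := by
    simp_rw [Real.fourier_eq', smul_eq_mul, mul_left_comm _ (c : ℂ)]
    exact integral_const_mul _ _
  simp_rw [fourierExpNorm, h]
  rw [← lintegral_const_mul' _ _ ENNReal.ofReal_ne_top]
  refine lintegral_congr fun w ↦ ?_
  rw [enorm_mul, ← ofReal_norm (c : ℂ), Complex.norm_of_nonneg hc, mul_assoc]

/-- The unit vector of Euclidean phase space in the direction `x_j`. -/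
def dirX (j : Fin d) : PhaseE d := EuclideanSpace.single (Sum.inl j) 1

/-- The unit vector of Euclidean phase space in the direction `ξ_j`. -/
def dirXi (j : Fin d) : PhaseE d := EuclideanSpace.single (Sum.inr j) 1

theorem toPd_dirX (j : Fin d) : toPd d (dirX j) = ex j := by
  ext i <;> simp [toPd_apply, dirX, ex, Pi.single_apply]

theorem toPd_dirXi (j : Fin d) : toPd d (dirXi j) = exi j := by
  ext i <;> simp [toPd_apply, dirXi, exi, Pi.single_apply]

theorem bracket_rescaled (a b : Pd d → ℂ) :
    bracket dirX dirXi (rescaled a) (rescaled b) =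
      fun x ↦ (((2 * π) ^ 2 : ℝ) : ℂ) * rescaled (poisson a b) x := by
  ext x
  simp_rw [bracket, rescaled, poisson, fderiv_rescaled, toPd_dirX, toPd_dirXi, Finset.mul_sum]
  refine Finset.sum_congr rfl fun j _ ↦ ?_
  push_cast
  ring

theorem sum_abs_inner_mul_le (u v : PhaseE d) :
    ∑ j, (|inner ℝ u (dirXi j)| * |inner ℝ v (dirX j)| +
      |inner ℝ u (dirX j)| * |inner ℝ v (dirXi j)|) ≤ ‖u‖ * ‖v‖ := by
  have h := Real.sum_mul_le_sqrt_mul_sqrt Finset.univ (fun i ↦ |u i|) fun i ↦ |v i.swap|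
  simp only [Fintype.sum_sum_type, Sum.swap_inl, Sum.swap_inr, sq_abs] at h
  rw [add_comm (∑ j, v (Sum.inr j) ^ 2)] at h
  simp only [EuclideanSpace.norm_eq, Real.norm_eq_abs, sq_abs, Fintype.sum_sum_type]
  refine le_trans (le_of_eq ?_) h
  rw [Finset.sum_add_distrib, add_comm]
  simp [dirX, dirXi, EuclideanSpace.inner_single_right]

end PhaseSpace

/-- For a, b ∈ A_s, the Poisson bracket {a,b} belongs to
A_{s−σ₁−σ₂} and ‖{a,b}‖_{s−σ₁−σ₂} ≤ (2/(e²σ₁(σ₁+σ₂))) ‖a‖_s ‖b‖_{s−σ₂}. -/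
theorem poisson_bound {d : ℕ} (s σ₁ σ₂ : ℝ) (hs : 0 < s)
    (hσ₁ : 0 < σ₁) (hσ₂ : 0 < σ₂) (hσs : σ₁ + σ₂ < s)
    (a b : Pd d → ℂ) (ha_cont : Continuous a) (hb_cont : Continuous b)
    (ha : MemAs s a) (hb : MemAs s b) :
    MemAs (s - σ₁ - σ₂) (poisson a b) ∧
      Anorm (s - σ₁ - σ₂) (poisson a b) ≤
        ENNReal.ofReal (2 / (Real.exp 1 ^ 2 * σ₁ * (σ₁ + σ₂))) *
          Anorm s a * Anorm (s - σ₂) b := by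
  have hc : (0 : ℝ) < (2 * π) ^ 2 := by positivity
  have hK : (1 : ℝ) ≤ (2 * π) ^ Module.finrank ℝ (PhaseE d) :=
    one_le_pow₀ (by linarith [pi_gt_three])
  have hs' : 0 < s - σ₁ - σ₂ := by linarith
  have hτ : s - σ₁ - σ₂ + σ₁ = s - σ₂ := by ring
  have hσ : s - σ₁ - σ₂ + (σ₁ + σ₂) = s := by ring
  have hA := integrable_rescaled_iff.2 ha.1
  have hB := integrable_rescaled_iff.2 hb.1
  have hAc := continuous_rescaled ha_cont
  have hBc := continuous_rescaled hb_cont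
  have hAs := fourierExpNorm_lt_top ha.2
  have hbs : Anorm (s - σ₂) b < ⊤ := by
    refine lt_of_le_of_lt (lintegral_mono fun w ↦ ENNReal.ofReal_le_ofReal ?_) hb.2
    have : 0 ≤ normP w := Real.sqrt_nonneg _
    gcongr
    linarith
  have hBs := fourierExpNorm_lt_top hbs
  have hbound : Anorm (s - σ₁ - σ₂) (poisson a b) ≤
      ENNReal.ofReal (2 / (Real.exp 1 ^ 2 * σ₁ * (σ₁ + σ₂))) *
        Anorm s a * Anorm (s - σ₂) b := by
    have h := fourierExpNorm_bracket_le sum_abs_inner_mul_le hAc hA hBc hB hs'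
      (add_pos hσ₁ hσ₂) hσ₁ (by rwa [hσ]) (by rwa [hτ])
    rw [hσ, hτ, bracket_rescaled, fourierExpNorm_const_mul _ hc.le,
      ENNReal.mul_le_mul_iff_right (ENNReal.ofReal_pos.2 hc).ne' ENNReal.ofReal_ne_top] at h
    have hconst : ENNReal.ofReal (1 / (exp 1 * (σ₁ + σ₂))) * ENNReal.ofReal (1 / (exp 1 * σ₁)) ≤
        ENNReal.ofReal (2 / (Real.exp 1 ^ 2 * σ₁ * (σ₁ + σ₂))) := by
      rw [← ENNReal.ofReal_mul (by positivity)]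
      refine ENNReal.ofReal_le_ofReal ?_
      rw [div_mul_div_comm, show exp 1 * (σ₁ + σ₂) * (exp 1 * σ₁) =
        exp 1 ^ 2 * σ₁ * (σ₁ + σ₂) by ring]
      gcongr
      norm_num
    simp_rw [Anorm_eq_fourierExpNorm]
    set K := ENNReal.ofReal ((2 * π) ^ Module.finrank ℝ (PhaseE d))
    have hK' : 1 ≤ K := ENNReal.one_le_ofReal.2 hK
    calc K * fourierExpNorm (s - σ₁ - σ₂) (rescaled (poisson a b))
        ≤ K * _ := mul_le_mul' le_rfl h
      _ = (ENNReal.ofReal (1 / (exp 1 * (σ₁ + σ₂))) * ENNReal.ofReal (1 / (exp 1 * σ₁))) *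
          (K * fourierExpNorm s (rescaled a)) * (1 * fourierExpNorm (s - σ₂) (rescaled b)) := by
          ring
      _ ≤ _ := by gcongr
  refine ⟨⟨?_, hbound.trans_lt ?_⟩, hbound⟩
  · have h := integrable_bracket dirX dirXi hAc hA hBc hB hs (by linarith) hAs hBs
    rw [bracket_rescaled, integrable_const_mul_iff (by simp [pi_ne_zero])] at h
    exact integrable_rescaled_iff.1 h
  · exact ENNReal.mul_lt_top (ENNReal.mul_lt_top ENNReal.ofReal_lt_top ha.2) hbs

end
end
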